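/- Let f ∈ V_10 and set j_2 = (f,f)_10, k = (f,f)_8 ∈ V_4, q = (f,f)_6 ∈ V_8. If j_2 = 0, k = 0, q ≠ 0 and q has a root of multiplicity at least 5 (i.e., q is a nullform of V_8), then f has a root of multiplicity at least 7. -/

import Mathlib

open MvPolynomial

/-- The `k`-th transvectant of two binary forms `f` of degree `n` and `g` of degree `m`. -/
noncomputable def transv (n m k : ℕ)
    (f g : MvPolynomial (Fin 2) ℂ) : MvPolynomial (Fin 2) ℂ :=
  ((((n - k).factorial * (m - k).factorial : ℕ) : ℂ) / ((n.factorial * m.factorial : ℕ) : ℂ)) •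
    ∑ i ∈ Finset.range (k + 1),
      ((-1 : ℂ) ^ i * (k.choose i : ℂ)) •
        ((fun p => pderiv (0 : Fin 2) p)^[k - i] ((fun p => pderiv (1 : Fin 2) p)^[i] f) *
         (fun p => pderiv (0 : Fin 2) p)^[i] ((fun p => pderiv (1 : Fin 2) p)^[k - i] g))

/-- A binary form `f` has a root of multiplicity (at least) `r` if some nonzero linear
form `ℓ = αx + βy` satisfies `ℓ^r ∣ f`. -/
def HasRootOfMult (r : ℕ) (f : MvPolynomial (Fin 2) ℂ) : Prop :=
  ∃ a b : ℂ, (a ≠ 0 ∨ b ≠ 0) ∧ (C a * X 0 + C b * X 1) ^ r ∣ f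

/-- The binary form `∑ᵢ cᵢ X₀ⁿ⁻ⁱ X₁ⁱ` of degree `n`. -/
noncomputable def binForm (n : ℕ) (c : ℕ → ℂ) : MvPolynomial (Fin 2) ℂ :=
  ∑ i ∈ Finset.range (n + 1), C (c i) * (X 0 ^ (n - i) * X 1 ^ i)

lemma coeff_binForm (n : ℕ) (c : ℕ → ℂ) (m : Fin 2 →₀ ℕ) :
    coeff m (binForm n c) = if m 0 + m 1 = n then c (m 1) else 0 := by
  have key (i : ℕ) : coeff m (C (c i) * (X 0 ^ (n - i) * X 1 ^ i)) =
      if n - i = m 0 ∧ i = m 1 then c i else 0 := by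
    have : (X 0 ^ (n - i) * X 1 ^ i : MvPolynomial (Fin 2) ℂ) =
        monomial (Finsupp.single 0 (n - i) + Finsupp.single 1 i) 1 := by
      simp [X_pow_eq_monomial, monomial_mul]
    rw [this, C_mul_monomial, coeff_monomial]
    refine if_congr ?_ (mul_one _) rfl
    simp [Finsupp.ext_iff, Fin.forall_fin_two]
  simp only [binForm, coeff_sum, key]
  split_ifs with h
  · rw [Finset.sum_eq_single (m 1)]
    · rw [if_pos ⟨by omega, rfl⟩]
    · intro i _ hi
      rw [if_neg (fun h => hi h.2)]
    · intro hm
      simp only [Finset.mem_range] at hm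
      omega
  · refine Finset.sum_eq_zero fun i hi => if_neg fun h' => ?_
    simp only [Finset.mem_range] at hi
    omega

lemma eq_binForm_of_isHomogeneous {n : ℕ} {f : MvPolynomial (Fin 2) ℂ}
    (hf : f.IsHomogeneous n) :
    f = binForm n fun i => coeff (Finsupp.single 0 (n - i) + Finsupp.single 1 i) f := by
  ext m
  rw [coeff_binForm]
  split_ifs with h
  · congr 1
    ext i
    fin_cases i
    · simp [← h]
    · simp
  · refine hf.coeff_eq_zero fun h' => h ?_
    rw [← h', Finsupp.degree_eq_sum, Fin.sum_univ_two]

lemma sum_smul_binForm {ι : Type*} (s : Finset ι) (r : ι → ℂ) (n : ℕ) (c : ι → ℕ → ℂ) :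
    ∑ i ∈ s, r i • binForm n (c i) = binForm n fun j => ∑ i ∈ s, r i * c i j := by
  ext m
  simp only [coeff_sum, coeff_smul, coeff_binForm, smul_eq_mul]
  split_ifs <;> simp

lemma binForm_coeff_eq_zero {n : ℕ} {c : ℕ → ℂ} (h : binForm n c = 0) {j : ℕ} (hj : j ≤ n) :
    c j = 0 := by
  have := coeff_binForm n c (Finsupp.single 0 (n - j) + Finsupp.single 1 j)
  simpa [h, Nat.sub_add_cancel hj] using this.symm

lemma binForm_coeff_eq_zero_of_X_pow_dvd {n r : ℕ} {c : ℕ → ℂ} (h : X 0 ^ r ∣ binForm n c)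
    {j : ℕ} (hj : j ≤ n) (hr : n < r + j) : c j = 0 := by
  obtain ⟨g, hg⟩ := h
  have := coeff_binForm n c (Finsupp.single 0 (n - j) + Finsupp.single 1 j)
  rw [hg, X_pow_eq_monomial, coeff_monomial_mul', if_neg] at this
  · simpa [Nat.sub_add_cancel hj] using this.symm
  · intro hle
    have := hle 0
    simp at this
    omega

lemma binForm_eq_zero {n : ℕ} {c : ℕ → ℂ} (h : ∀ j ≤ n, c j = 0) : binForm n c = 0 := by
  refine Finset.sum_eq_zero fun j hj => ?_
  rw [h j (by simpa [Nat.lt_succ_iff] using hj), C_0, zero_mul]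

lemma X_pow_dvd_binForm {n r : ℕ} {c : ℕ → ℂ} (h : ∀ j ≤ n, n < r + j → c j = 0) :
    X 0 ^ r ∣ binForm n c := by
  refine Finset.dvd_sum fun j hj => ?_
  simp only [Finset.mem_range] at hj
  by_cases hr : n < r + j
  · simp [h j (by omega) hr]
  · exact ((pow_dvd_pow _ (by omega)).mul_right _).mul_left _

/-- The binary form of degree `n` with normalized coefficients `a`. -/
noncomputable def normForm (n : ℕ) (a : ℕ → ℂ) : MvPolynomial (Fin 2) ℂ :=
  binForm n fun i => n.choose i * a i

lemma pderiv_zero_normForm (n : ℕ) (a : ℕ → ℂ) :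
    pderiv 0 (normForm (n + 1) a) = ((n + 1 : ℕ) : ℂ) • normForm n a := by
  ext m
  simp only [normForm, coeff_pderiv, coeff_smul, coeff_binForm, smul_eq_mul]
  have e : (m + Finsupp.single 0 1 : Fin 2 →₀ ℕ) 0 + (m + Finsupp.single 0 1 : Fin 2 →₀ ℕ) 1 = n + 1 ↔
      m 0 + m 1 = n := by
    simp
    omega
  simp only [e]
  split_ifs with h
  · have := Nat.choose_mul_succ_eq n (m 1)
    rw [show n + 1 - m 1 = m 0 + 1 by omega] at this
    have h2 : ((n.choose (m 1) : ℂ)) * (n + 1) = (n + 1).choose (m 1) * (m 0 + 1) := by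
      exact_mod_cast this
    simp
    linear_combination (-a (m 1)) * h2
  · simp

lemma pderiv_one_normForm (n : ℕ) (a : ℕ → ℂ) :
    pderiv 1 (normForm (n + 1) a) = ((n + 1 : ℕ) : ℂ) • normForm n fun i => a (i + 1) := by
  ext m
  simp only [normForm, coeff_pderiv, coeff_smul, coeff_binForm, smul_eq_mul]
  have e : (m + Finsupp.single 1 1 : Fin 2 →₀ ℕ) 0 + (m + Finsupp.single 1 1 : Fin 2 →₀ ℕ) 1 = n + 1 ↔
      m 0 + m 1 = n := by
    simp
    omega
  simp only [e]
  split_ifs with h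
  · have h2 : ((n : ℂ) + 1) * n.choose (m 1) = (n + 1).choose (m 1 + 1) * (m 1 + 1) := by
      exact_mod_cast Nat.add_one_mul_choose_eq n (m 1)
    simp
    linear_combination (-a (m 1 + 1)) * h2
  · simp

lemma iterate_pderiv_zero_normForm (n p : ℕ) (a : ℕ → ℂ) :
    (fun f => pderiv (0 : Fin 2) f)^[p] (normForm (n + p) a) =
      ((n + p).descFactorial p : ℂ) • normForm n a := by
  induction p generalizing n with
  | zero => simp
  | succ p ih =>
    rw [Function.iterate_succ_apply', show n + (p + 1) = n + 1 + p by ring, ih]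
    simp only [Derivation.map_smul, pderiv_zero_normForm, smul_smul]
    rw [Nat.descFactorial_succ, Nat.add_sub_cancel, mul_comm, Nat.cast_mul]

lemma iterate_pderiv_one_normForm (n p : ℕ) (a : ℕ → ℂ) :
    (fun f => pderiv (1 : Fin 2) f)^[p] (normForm (n + p) a) =
      ((n + p).descFactorial p : ℂ) • normForm n fun i => a (i + p) := by
  induction p generalizing n with
  | zero => simp
  | succ p ih =>
    rw [Function.iterate_succ_apply', show n + (p + 1) = n + 1 + p by ring, ih]
    simp only [Derivation.map_smul, pderiv_one_normForm, smul_smul]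
    rw [Nat.descFactorial_succ, Nat.add_sub_cancel, mul_comm, Nat.cast_mul]
    simp only [add_assoc, add_comm 1]

lemma iterate_pderiv_normForm (n p i : ℕ) (a : ℕ → ℂ) :
    (fun f => pderiv (0 : Fin 2) f)^[p]
        ((fun f => pderiv (1 : Fin 2) f)^[i] (normForm (n + (p + i)) a)) =
      (((n + (p + i)).factorial : ℂ) / n.factorial) • normForm n fun j => a (j + i) := by
  have smul_iter (r : ℂ) (f : MvPolynomial (Fin 2) ℂ) :
      (fun f => pderiv (0 : Fin 2) f)^[p] (r • f) =
        r • (fun f => pderiv (0 : Fin 2) f)^[p] f := by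
    induction p generalizing f with
    | zero => rfl
    | succ p ih => simp [ih]
  rw [← add_assoc, iterate_pderiv_one_normForm, smul_iter, iterate_pderiv_zero_normForm, smul_smul]
  congr 1
  rw [eq_div_iff (by exact_mod_cast n.factorial_ne_zero)]
  have h1 := Nat.factorial_mul_descFactorial (Nat.le_add_left i (n + p))
  have h2 := Nat.factorial_mul_descFactorial (Nat.le_add_left p n)
  rw [Nat.add_sub_cancel] at h1 h2
  rw [← h1, ← h2]
  push_cast
  ring

lemma transv_normForm (d k : ℕ) (a b : ℕ → ℂ) :
    transv (d + k) (d + k) k (normForm (d + k) a) (normForm (d + k) b) =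
      ∑ i ∈ Finset.range (k + 1), ((-1 : ℂ) ^ i * (k.choose i : ℂ)) •
        (normForm d (fun j => a (j + i)) * normForm d fun j => b (j + (k - i))) := by
  have hd : (d.factorial : ℂ) ≠ 0 := by exact_mod_cast d.factorial_ne_zero
  have hdk : ((d + k).factorial : ℂ) ≠ 0 := by exact_mod_cast (d + k).factorial_ne_zero
  rw [transv, Finset.smul_sum]
  refine Finset.sum_congr rfl fun i hi => ?_
  simp only [Finset.mem_range] at hi
  have h1 := iterate_pderiv_normForm d (k - i) i a
  have h2 := iterate_pderiv_normForm d i (k - i) b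
  rw [Nat.sub_add_cancel (by omega)] at h1
  rw [Nat.add_sub_cancel' (by omega)] at h2
  rw [h1, h2, smul_mul_smul_comm, smul_smul, smul_smul]
  congr 1
  rw [Nat.add_sub_cancel]
  push_cast
  field_simp

/-- The coefficients of the product of two forms of degree `d` with normalized coefficients
`a` and `b`. -/
noncomputable def prodCoeff (d : ℕ) (a b : ℕ → ℂ) (j : ℕ) : ℂ :=
  ∑ s ∈ Finset.range (j + 1), d.choose s * a s * (d.choose (j - s) * b (j - s))

lemma normForm_mul_normForm (d : ℕ) (a b : ℕ → ℂ) :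
    normForm d a * normForm d b = binForm (2 * d) (prodCoeff d a b) := by
  have hrhs : binForm (2 * d) (prodCoeff d a b) =
      ∑ j ∈ Finset.range (2 * d + 1), ∑ s ∈ Finset.range (j + 1),
        C (d.choose s * a s * (d.choose (j - s) * b (j - s))) *
          (X 0 ^ (2 * d - (s + (j - s))) * X 1 ^ (s + (j - s))) := by
    refine Finset.sum_congr rfl fun j _ => ?_
    rw [prodCoeff, map_sum, Finset.sum_mul]
    refine Finset.sum_congr rfl fun s hs => ?_
    rw [Nat.add_sub_cancel' (by simpa [Nat.lt_succ_iff] using hs)]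
  rw [hrhs, Finset.sum_range_diag_flip (2 * d + 1) fun s t =>
    (C (d.choose s * a s * (d.choose t * b t)) *
      (X 0 ^ (2 * d - (s + t)) * X 1 ^ (s + t)) : MvPolynomial (Fin 2) ℂ)]
  simp only [normForm, binForm, Finset.sum_mul_sum]
  rw [← Finset.sum_subset (Finset.range_subset_range.mpr (by omega : d + 1 ≤ 2 * d + 1))]
  · refine Finset.sum_congr rfl fun s hs => ?_
    simp only [Finset.mem_range] at hs
    rw [← Finset.sum_subset
      (Finset.range_subset_range.mpr (by omega : d + 1 ≤ 2 * d + 1 - s))]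
    · refine Finset.sum_congr rfl fun t ht => ?_
      simp only [Finset.mem_range] at ht
      rw [show 2 * d - (s + t) = (d - s) + (d - t) by omega, C_mul (a := d.choose s * a s), pow_add,
        pow_add]
      ring
    · intro t _ ht
      simp only [Finset.mem_range, not_lt] at ht
      simp [Nat.choose_eq_zero_of_lt (show d < t by omega)]
  · intro s _ hs
    simp only [Finset.mem_range, not_lt] at hs
    simp [Nat.choose_eq_zero_of_lt (show d < s by omega)]

/-- The coefficients of the `k`-th transvectant of a form of degree `d + k` with itself. -/
noncomputable def transvCoeff (d k : ℕ) (a : ℕ → ℂ) (j : ℕ) : ℂ :=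
  ∑ i ∈ Finset.range (k + 1), ((-1 : ℂ) ^ i * (k.choose i : ℂ)) *
    prodCoeff d (fun j => a (j + i)) (fun j => a (j + (k - i))) j

lemma transv_normForm_self (d k : ℕ) (a : ℕ → ℂ) :
    transv (d + k) (d + k) k (normForm (d + k) a) (normForm (d + k) a) =
      binForm (2 * d) (transvCoeff d k a) := by
  rw [transv_normForm]
  simp only [normForm_mul_normForm]
  exact sum_smul_binForm _ _ _ _

lemma exists_eq_normForm {n : ℕ} {f : MvPolynomial (Fin 2) ℂ} (hf : f.IsHomogeneous n) :
    ∃ a, f = normForm n a := by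
  refine ⟨fun i => coeff (Finsupp.single 0 (n - i) + Finsupp.single 1 i) f / n.choose i, ?_⟩
  conv_lhs => rw [eq_binForm_of_isHomogeneous hf]
  refine Finset.sum_congr rfl fun i hi => ?_
  have : (n.choose i : ℂ) ≠ 0 := by
    exact_mod_cast (Nat.choose_pos (by simpa [Nat.lt_succ_iff] using hi)).ne'
  field_simp

/-- The linear substitution `X₀ ↦ a X₀ + b X₁`, `X₁ ↦ c X₀ + d X₁`. -/
noncomputable def linSubst (a b c d : ℂ) :
    MvPolynomial (Fin 2) ℂ →ₐ[ℂ] MvPolynomial (Fin 2) ℂ :=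
  aeval ![C a * X 0 + C b * X 1, C c * X 0 + C d * X 1]

lemma linSubst_isHomogeneous (a b c d : ℂ) {n : ℕ} {f : MvPolynomial (Fin 2) ℂ}
    (hf : f.IsHomogeneous n) : (linSubst a b c d f).IsHomogeneous n := by
  have h (u v : ℂ) : (C u * X 0 + C v * X 1 : MvPolynomial (Fin 2) ℂ).IsHomogeneous 1 :=
    ((isHomogeneous_X _ _).C_mul _).add ((isHomogeneous_X _ _).C_mul _)
  have := hf.aeval ![C a * X 0 + C b * X 1, C c * X 0 + C d * X 1]
    (n := 1) (Fin.forall_fin_two.mpr ⟨h a b, h c d⟩)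
  rwa [one_mul] at this

lemma linSubst_linSubst_inv {a b c d : ℂ} (h : a * d - b * c = 1) (f : MvPolynomial (Fin 2) ℂ) :
    linSubst a b c d (linSubst d (-b) (-c) a f) = f := by
  have hC : (C a * C d - C b * C c : MvPolynomial (Fin 2) ℂ) = 1 := by
    rw [← C_mul, ← C_mul, ← C_sub, h, C_1]
  suffices (linSubst a b c d).comp (linSubst d (-b) (-c) a) = AlgHom.id ℂ _ from
    DFunLike.congr_fun this f
  ext i : 1
  fin_cases i
  · simp [linSubst]
    linear_combination X 0 * hC
  · simp [linSubst]
    linear_combination X 1 * hC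

/-- The partial derivative as a linear endomorphism. -/
noncomputable def pderivLin (i : Fin 2) : Module.End ℂ (MvPolynomial (Fin 2) ℂ) :=
  (pderiv i).toLinearMap

lemma pderiv_linSubst (a b c d : ℂ) (f : MvPolynomial (Fin 2) ℂ) :
    pderiv 0 (linSubst a b c d f) =
        linSubst a b c d (a • pderiv 0 f + c • pderiv 1 f) ∧
      pderiv 1 (linSubst a b c d f) =
        linSubst a b c d (b • pderiv 0 f + d • pderiv 1 f) := by
  induction f using MvPolynomial.induction_on with
  | C r => simp [linSubst]
  | add p q hp hq =>
    simp only [map_add, hp, hq, smul_add]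
    constructor <;> ring
  | mul_X p i hp =>
    simp only [map_mul, pderiv_mul, hp.1, hp.2]
    fin_cases i <;> simp [linSubst, smul_eq_C_mul, pderiv_X] <;>
      constructor <;> ring

open TensorProduct in
/-- Cayley's Omega operator on the tensor square of the polynomial ring. -/
noncomputable def cayleyOmega :
    Module.End ℂ (MvPolynomial (Fin 2) ℂ ⊗[ℂ] MvPolynomial (Fin 2) ℂ) :=
  TensorProduct.map (pderivLin 0) (pderivLin 1) - TensorProduct.map (pderivLin 1) (pderivLin 0)

lemma commute_pderivLin : Commute (pderivLin 0) (pderivLin 1) := by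
  refine LinearMap.ext fun f => ?_
  ext m
  simp only [pderivLin, Module.End.mul_apply, Derivation.coeFn_coe, coeff_pderiv]
  rw [add_right_comm]
  simp
  ring

lemma iterate_pderiv (i : Fin 2) (p : ℕ) :
    (fun f => pderiv i f)^[p] = ⇑(pderivLin i ^ p) := by
  rw [Module.End.coe_pow]
  rfl

lemma sub_pow_of_commute {R A : Type*} [CommRing R] [Ring A] [Algebra R A] {x y : A}
    (h : Commute x y) (k : ℕ) :
    (x - y) ^ k =
      ∑ i ∈ Finset.range (k + 1), ((-1 : R) ^ i * (k.choose i : R)) • (x ^ (k - i) * y ^ i) := by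
  rw [← neg_add_eq_sub, (Commute.neg_left h.symm).add_pow]
  refine Finset.sum_congr rfl fun i _ => ?_
  rw [neg_pow, (h.pow_pow (k - i) i).eq, ← (Nat.cast_commute (k.choose i) _).eq, ← mul_assoc,
    ← mul_assoc, Algebra.smul_def, (Nat.cast_commute (k.choose i) _).eq]
  simp [mul_assoc]

open TensorProduct in
lemma transv_eq_cayleyOmega_pow (n m k : ℕ) (f g : MvPolynomial (Fin 2) ℂ) :
    transv n m k f g =
      ((((n - k).factorial * (m - k).factorial : ℕ) : ℂ) /
        ((n.factorial * m.factorial : ℕ) : ℂ)) •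
          LinearMap.mul' ℂ _ ((cayleyOmega ^ k) (f ⊗ₜ g)) := by
  have hc : Commute (S := Module.End ℂ (MvPolynomial (Fin 2) ℂ ⊗[ℂ] MvPolynomial (Fin 2) ℂ))
      (TensorProduct.map (pderivLin 0) (pderivLin 1))
      (TensorProduct.map (pderivLin 1) (pderivLin 0)) := by
    rw [commute_iff_eq, ← TensorProduct.map_mul, ← TensorProduct.map_mul, commute_pderivLin.eq]
  have hpow := sub_pow_of_commute (R := ℂ)
    (A := Module.End ℂ (MvPolynomial (Fin 2) ℂ ⊗[ℂ] MvPolynomial (Fin 2) ℂ)) hc k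
  change cayleyOmega ^ k = _ at hpow
  rw [transv, hpow, LinearMap.sum_apply, map_sum]
  congr 1
  refine Finset.sum_congr rfl fun i _ => ?_
  rw [TensorProduct.map_pow, TensorProduct.map_pow, ← TensorProduct.map_mul,
    (commute_pderivLin.symm.pow_pow (k - i) i).eq]
  simp [iterate_pderiv, Module.End.mul_apply]

open TensorProduct in
lemma transv_linSubst {a b c d : ℂ} (h : a * d - b * c = 1) (n m k : ℕ)
    (f g : MvPolynomial (Fin 2) ℂ) :
    transv n m k (linSubst a b c d f) (linSubst a b c d g) =
      linSubst a b c d (transv n m k f g) := by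
  set L := linSubst a b c d with hL
  have h0 : pderivLin 0 ∘ₗ L.toLinearMap = L.toLinearMap ∘ₗ (a • pderivLin 0 + c • pderivLin 1) :=
    LinearMap.ext fun f => (pderiv_linSubst a b c d f).1
  have h1 : pderivLin 1 ∘ₗ L.toLinearMap = L.toLinearMap ∘ₗ (b • pderivLin 0 + d • pderivLin 1) :=
    LinearMap.ext fun f => (pderiv_linSubst a b c d f).2
  have hω : cayleyOmega ∘ₗ TensorProduct.map L.toLinearMap L.toLinearMap =
      TensorProduct.map L.toLinearMap L.toLinearMap ∘ₗ cayleyOmega := by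
    rw [cayleyOmega, LinearMap.sub_comp, ← TensorProduct.map_comp, ← TensorProduct.map_comp, h0, h1,
      TensorProduct.map_comp, TensorProduct.map_comp, ← LinearMap.comp_sub]
    congr 1
    simp only [TensorProduct.map_add_left, TensorProduct.map_add_right,
      TensorProduct.map_smul_left, TensorProduct.map_smul_right]
    match_scalars <;> first | ring1 | linear_combination h | linear_combination -h
  have hpow : (cayleyOmega ^ k) ∘ₗ TensorProduct.map L.toLinearMap L.toLinearMap =
      TensorProduct.map L.toLinearMap L.toLinearMap ∘ₗ (cayleyOmega ^ k) := by
    induction k with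
    | zero => rfl
    | succ k ih =>
      rw [pow_succ, Module.End.mul_eq_comp, LinearMap.comp_assoc, hω, ← LinearMap.comp_assoc, ih,
        LinearMap.comp_assoc]
  have hmul : LinearMap.mul' ℂ _ ∘ₗ TensorProduct.map L.toLinearMap L.toLinearMap =
      L.toLinearMap ∘ₗ LinearMap.mul' ℂ _ :=
    TensorProduct.ext' fun x y => by simp
  rw [transv_eq_cayleyOmega_pow, transv_eq_cayleyOmega_pow, map_smul]
  congr 1
  have e1 := LinearMap.congr_fun hpow (f ⊗ₜ g)
  have e2 := LinearMap.congr_fun hmul ((cayleyOmega ^ k) (f ⊗ₜ g))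
  simp only [LinearMap.comp_apply, TensorProduct.map_tmul, AlgHom.toLinearMap_apply] at e1 e2
  rw [e1, e2]

/-- If the lower half of the coefficients of `(f,f)₆` vanishes, together with `(f,f)₈` and
`(f,f)₁₀`, and the last coefficient of `f` is nonzero, then `(f,f)₆ = 0`. -/
lemma q_eq_zero_of_lead_10 (a0 a1 a2 a3 a4 a5 a6 a7 a8 a9 a10 : ℂ) (h : a10 ≠ 0)
    (q4 : a0 * a10 + 10 * a1 * a9 - 45 * a2 * a8 + 20 * a3 * a7 + 140 * a4 * a6 - 126 * a5 ^ 2 =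
      0)
    (q5 : a1 * a10 - 15 * a3 * a8 + 35 * a4 * a7 - 21 * a5 * a6 = 0)
    (q6 : 3 * a2 * a10 - 10 * a3 * a9 + 42 * a5 * a7 - 35 * a6 ^ 2 = 0)
    (q7 : a3 * a10 - 5 * a4 * a9 + 9 * a5 * a8 - 5 * a6 * a7 = 0)
    (q8 : a4 * a10 - 6 * a5 * a9 + 15 * a6 * a8 - 10 * a7 ^ 2 = 0)
    (k1 : a0 * a9 - 7 * a1 * a8 + 20 * a2 * a7 - 28 * a3 * a6 + 14 * a4 * a5 = 0)
    (k2 : a0 * a10 - 4 * a1 * a9 - 3 * a2 * a8 + 48 * a3 * a7 - 126 * a4 * a6 + 84 * a5 ^ 2 = 0)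
    (k3 : a1 * a10 - 7 * a2 * a9 + 20 * a3 * a8 - 28 * a4 * a7 + 14 * a5 * a6 = 0)
    (k4 : a2 * a10 - 8 * a3 * a9 + 28 * a4 * a8 - 56 * a5 * a7 + 35 * a6 ^ 2 = 0)
    (j0 : a0 * a10 - 10 * a1 * a9 + 45 * a2 * a8 - 120 * a3 * a7 + 210 * a4 * a6 - 126 * a5 ^ 2
      = 0) :
    a0 * a6 - 6 * a1 * a5 + 15 * a2 * a4 - 10 * a3 ^ 2 = 0 ∧
    a0 * a7 - 5 * a1 * a6 + 9 * a2 * a5 - 5 * a3 * a4 = 0 ∧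
    3 * a0 * a8 - 10 * a1 * a7 + 42 * a3 * a5 - 35 * a4 ^ 2 = 0 ∧
    a0 * a9 - 15 * a2 * a7 + 35 * a3 * a6 - 21 * a4 * a5 = 0 := by
  have q3 : a0 * a9 - 15 * a2 * a7 + 35 * a3 * a6 - 21 * a4 * a5 = 0 := by
    refine (mul_eq_zero.mp ?_).resolve_left h
    linear_combination a9 * q4 - 10 * a8 * q5 + 10 * a7 * q6 - 35 * a6 * q7 + 14 * a5 * q8 - (5/2) * a10 * k1 +
      (5/2) * a9 * k2 - (15/2) * a8 * k3 + 5 * a7 * k4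
  have q2 : 3 * a0 * a8 - 10 * a1 * a7 + 42 * a3 * a5 - 35 * a4 ^ 2 = 0 := by
    refine (mul_eq_zero.mp ?_).resolve_left h
    linear_combination (3/2) * a8 * q4 - 10 * a7 * q5 + 42 * a5 * q7 - 35 * a4 * q8 + (3/2) * a8 * j0
  have q1 : a0 * a7 - 5 * a1 * a6 + 9 * a2 * a5 - 5 * a3 * a4 = 0 := by
    refine (mul_eq_zero.mp ?_).resolve_left h
    linear_combination (1/2) * a7 * q4 - 5 * a6 * q5 + 3 * a5 * q6 - 5 * a3 * q8 + (1/2) * a7 * j0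
  have q0 : a0 * a6 - 6 * a1 * a5 + 15 * a2 * a4 - 10 * a3 ^ 2 = 0 := by
    refine (mul_eq_zero.mp ?_).resolve_left h
    linear_combination (1/2) * a6 * q4 - 6 * a5 * q5 + 5 * a4 * q6 - 10 * a3 * q7 + (1/2) * a6 * j0
  exact ⟨q0, q1, q2, q3⟩

lemma q_eq_zero_of_lead_9 (a0 a1 a2 a3 a4 a5 a6 a7 a8 a9 : ℂ) (h : a9 ≠ 0)
    (q4 : 10 * a1 * a9 - 45 * a2 * a8 + 20 * a3 * a7 + 140 * a4 * a6 - 126 * a5 ^ 2 = 0)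
    (q5 : -15 * a3 * a8 + 35 * a4 * a7 - 21 * a5 * a6 = 0)
    (q6 : -10 * a3 * a9 + 42 * a5 * a7 - 35 * a6 ^ 2 = 0)
    (q7 : -5 * a4 * a9 + 9 * a5 * a8 - 5 * a6 * a7 = 0)
    (q8 : -6 * a5 * a9 + 15 * a6 * a8 - 10 * a7 ^ 2 = 0)
    (k0 : a0 * a8 - 8 * a1 * a7 + 28 * a2 * a6 - 56 * a3 * a5 + 35 * a4 ^ 2 = 0)
    (k1 : a0 * a9 - 7 * a1 * a8 + 20 * a2 * a7 - 28 * a3 * a6 + 14 * a4 * a5 = 0)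
    (k2 : -4 * a1 * a9 - 3 * a2 * a8 + 48 * a3 * a7 - 126 * a4 * a6 + 84 * a5 ^ 2 = 0)
    (k3 : -7 * a2 * a9 + 20 * a3 * a8 - 28 * a4 * a7 + 14 * a5 * a6 = 0)
    (k4 : -8 * a3 * a9 + 28 * a4 * a8 - 56 * a5 * a7 + 35 * a6 ^ 2 = 0)
    (j0 : -10 * a1 * a9 + 45 * a2 * a8 - 120 * a3 * a7 + 210 * a4 * a6 - 126 * a5 ^ 2 = 0) :
    a0 * a6 - 6 * a1 * a5 + 15 * a2 * a4 - 10 * a3 ^ 2 = 0 ∧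
    a0 * a7 - 5 * a1 * a6 + 9 * a2 * a5 - 5 * a3 * a4 = 0 ∧
    3 * a0 * a8 - 10 * a1 * a7 + 42 * a3 * a5 - 35 * a4 ^ 2 = 0 ∧
    a0 * a9 - 15 * a2 * a7 + 35 * a3 * a6 - 21 * a4 * a5 = 0 := by
  have q3 : a0 * a9 - 15 * a2 * a7 + 35 * a3 * a6 - 21 * a4 * a5 = 0 := by
    refine (mul_eq_zero.mp ?_).resolve_left h
    linear_combination (1/10) * a8 * q4 + 2 * a7 * q5 - (7/2) * a6 * q6 + (77/5) * a5 * q7 - 7 * a4 * q8 + a9 * k1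
      - (3/2) * a8 * k2 + 5 * a7 * k3 - (7/2) * a6 * k4
  have q2 : 3 * a0 * a8 - 10 * a1 * a7 + 42 * a3 * a5 - 35 * a4 ^ 2 = 0 := by
    refine (mul_eq_zero.mp ?_).resolve_left h
    linear_combination (1/5) * a7 * q4 + 2 * a6 * q5 - (27/5) * a5 * q6 + 28 * a4 * q7 - 14 * a3 * q8 + 3 * a9 * k0
      - 3 * a7 * k2 + 12 * a6 * k3 - 9 * a5 * k4
  have q1 : a0 * a7 - 5 * a1 * a6 + 9 * a2 * a5 - 5 * a3 * a4 = 0 := by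
    refine (mul_eq_zero.mp ?_).resolve_left h
    linear_combination -(3/10) * a6 * q4 + (9/5) * a5 * q5 - (1/2) * a4 * q6 - 2 * a3 * q7 + 2 * a2 * q8 - (3/2) *
      a8 * k0 + a7 * k1 + (1/2) * a6 * k2 - 3 * a5 * k3 + (5/2) * a4 * k4 + (1/2) * a8 * q2
  have q0 : a0 * a6 - 6 * a1 * a5 + 15 * a2 * a4 - 10 * a3 ^ 2 = 0 := by
    refine (mul_eq_zero.mp ?_).resolve_left h
    linear_combination -(3/50) * a5 * q4 + (1/5) * a4 * q5 + (1/5) * a3 * q6 - (8/5) * a2 * q7 + (4/5) * a1 * q8 -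
      a7 * k0 + a6 * k1 - a4 * k3 + a3 * k4 + (3/50) * a5 * j0 + a8 * q1
  exact ⟨q0, q1, q2, q3⟩

lemma q_eq_zero_of_lead_8 (a0 a1 a2 a3 a4 a5 a6 a7 a8 : ℂ) (h : a8 ≠ 0)
    (q4 : -45 * a2 * a8 + 20 * a3 * a7 + 140 * a4 * a6 - 126 * a5 ^ 2 = 0)
    (q5 : -15 * a3 * a8 + 35 * a4 * a7 - 21 * a5 * a6 = 0)
    (q6 : 42 * a5 * a7 - 35 * a6 ^ 2 = 0)
    (q7 : 9 * a5 * a8 - 5 * a6 * a7 = 0)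
    (q8 : 15 * a6 * a8 - 10 * a7 ^ 2 = 0)
    (k0 : a0 * a8 - 8 * a1 * a7 + 28 * a2 * a6 - 56 * a3 * a5 + 35 * a4 ^ 2 = 0)
    (k1 : -7 * a1 * a8 + 20 * a2 * a7 - 28 * a3 * a6 + 14 * a4 * a5 = 0)
    (k2 : -3 * a2 * a8 + 48 * a3 * a7 - 126 * a4 * a6 + 84 * a5 ^ 2 = 0)
    (k3 : 20 * a3 * a8 - 28 * a4 * a7 + 14 * a5 * a6 = 0)
    (k4 : 28 * a4 * a8 - 56 * a5 * a7 + 35 * a6 ^ 2 = 0)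
    (j0 : 45 * a2 * a8 - 120 * a3 * a7 + 210 * a4 * a6 - 126 * a5 ^ 2 = 0) :
    a0 * a6 - 6 * a1 * a5 + 15 * a2 * a4 - 10 * a3 ^ 2 = 0 ∧
    a0 * a7 - 5 * a1 * a6 + 9 * a2 * a5 - 5 * a3 * a4 = 0 ∧
    3 * a0 * a8 - 10 * a1 * a7 + 42 * a3 * a5 - 35 * a4 ^ 2 = 0 ∧
    -15 * a2 * a7 + 35 * a3 * a6 - 21 * a4 * a5 = 0 := by
  have q3 : -15 * a2 * a7 + 35 * a3 * a6 - 21 * a4 * a5 = 0 := by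
    refine (mul_eq_zero.mp ?_).resolve_left h
    linear_combination (1/3) * a7 * q4 - (5/3) * a6 * q5 + a5 * q6 - (7/3) * a4 * q7 + (2/3) * a3 * q8
  have q2 : 3 * a0 * a8 - 10 * a1 * a7 + 42 * a3 * a5 - 35 * a4 ^ 2 = 0 := by
    refine (mul_eq_zero.mp ?_).resolve_left h
    linear_combination (17/45) * a6 * q4 + (106/15) * a5 * q5 - (107/9) * a4 * q6 + (316/9) * a3 * q7 - 4 * a2 * q8
      + 3 * a8 * k0 - 2 * a7 * k1 + (7/3) * a6 * k2 - 5 * a4 * k4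
  have q1 : a0 * a7 - 5 * a1 * a6 + 9 * a2 * a5 - 5 * a3 * a4 = 0 := by
    refine (mul_eq_zero.mp ?_).resolve_left h
    linear_combination (6/55) * a5 * q4 - (29/55) * a4 * q5 - (32/385) * a3 * q6 + (8/5) * a2 * q7 - (4/5) * a1 *
      q8 + a7 * k0 - a6 * k1 + (9/55) * a5 * k2 + (13/22) * a4 * k3 - (68/77) * a3 * k4
  have q0 : a0 * a6 - 6 * a1 * a5 + 15 * a2 * a4 - 10 * a3 ^ 2 = 0 := by
    refine (mul_eq_zero.mp ?_).resolve_left h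
    linear_combination (17/50) * a4 * q4 - (14/5) * a3 * q5 + (52/35) * a2 * q6 - (8/5) * a1 * q7 + a6 * k0 - (6/5)
      * a5 * k1 + (6/5) * a4 * k2 - (13/5) * a3 * k3 + (24/35) * a2 * k4 + (49/150) * a4 * j0
  exact ⟨q0, q1, q2, q3⟩

lemma upper_coeffs_eq_zero (a0 a1 a2 a3 a4 a5 a6 a7 a8 a9 a10 : ℂ)
    (q4 : a0 * a10 + 10 * a1 * a9 - 45 * a2 * a8 + 20 * a3 * a7 + 140 * a4 * a6 - 126 * a5 ^ 2 =
      0)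
    (q5 : a1 * a10 - 15 * a3 * a8 + 35 * a4 * a7 - 21 * a5 * a6 = 0)
    (q6 : 3 * a2 * a10 - 10 * a3 * a9 + 42 * a5 * a7 - 35 * a6 ^ 2 = 0)
    (q7 : a3 * a10 - 5 * a4 * a9 + 9 * a5 * a8 - 5 * a6 * a7 = 0)
    (q8 : a4 * a10 - 6 * a5 * a9 + 15 * a6 * a8 - 10 * a7 ^ 2 = 0)
    (k0 : a0 * a8 - 8 * a1 * a7 + 28 * a2 * a6 - 56 * a3 * a5 + 35 * a4 ^ 2 = 0)
    (k1 : a0 * a9 - 7 * a1 * a8 + 20 * a2 * a7 - 28 * a3 * a6 + 14 * a4 * a5 = 0)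
    (k2 : a0 * a10 - 4 * a1 * a9 - 3 * a2 * a8 + 48 * a3 * a7 - 126 * a4 * a6 + 84 * a5 ^ 2 = 0)
    (k3 : a1 * a10 - 7 * a2 * a9 + 20 * a3 * a8 - 28 * a4 * a7 + 14 * a5 * a6 = 0)
    (k4 : a2 * a10 - 8 * a3 * a9 + 28 * a4 * a8 - 56 * a5 * a7 + 35 * a6 ^ 2 = 0)
    (j0 : a0 * a10 - 10 * a1 * a9 + 45 * a2 * a8 - 120 * a3 * a7 + 210 * a4 * a6 - 126 * a5 ^ 2
      = 0)
    (hq : ¬(a0 * a6 - 6 * a1 * a5 + 15 * a2 * a4 - 10 * a3 ^ 2 = 0 ∧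
      a0 * a7 - 5 * a1 * a6 + 9 * a2 * a5 - 5 * a3 * a4 = 0 ∧
      3 * a0 * a8 - 10 * a1 * a7 + 42 * a3 * a5 - 35 * a4 ^ 2 = 0 ∧
      a0 * a9 - 15 * a2 * a7 + 35 * a3 * a6 - 21 * a4 * a5 = 0)) :
    a4 = 0 ∧ a5 = 0 ∧ a6 = 0 ∧ a7 = 0 ∧ a8 = 0 ∧ a9 = 0 ∧ a10 = 0 := by
  obtain rfl : a10 = 0 := by
    by_contra h
    exact hq (q_eq_zero_of_lead_10 a0 a1 a2 a3 a4 a5 a6 a7 a8 a9 a10 h q4 q5 q6 q7 q8 k1 k2 k3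
      k4 j0)
  obtain rfl : a9 = 0 := by
    by_contra h
    have := q_eq_zero_of_lead_9 a0 a1 a2 a3 a4 a5 a6 a7 a8 a9 h (by linear_combination q4) (by
      linear_combination q5) (by linear_combination q6) (by linear_combination q7) (by
      linear_combination q8) (by linear_combination k0) (by linear_combination k1) (by
      linear_combination k2) (by linear_combination k3) (by linear_combination k4) (by
      linear_combination j0)
    exact hq ⟨by linear_combination this.1, by linear_combination this.2.1,
      by linear_combination this.2.2.1, by linear_combination this.2.2.2⟩
  obtain rfl : a8 = 0 := by
    by_contra h
    have := q_eq_zero_of_lead_8 a0 a1 a2 a3 a4 a5 a6 a7 a8 h (by linear_combination q4) (by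
      linear_combination q5) (by linear_combination q6) (by linear_combination q7) (by
      linear_combination q8) (by linear_combination k0) (by linear_combination k1) (by
      linear_combination k2) (by linear_combination k3) (by linear_combination k4) (by
      linear_combination j0)
    exact hq ⟨by linear_combination this.1, by linear_combination this.2.1,
      by linear_combination this.2.2.1, by linear_combination this.2.2.2⟩
  obtain rfl : a7 = 0 := by
    refine pow_eq_zero_iff (two_ne_zero) |>.mp ?_
    linear_combination (-1 / 10) * q8
  obtain rfl : a6 = 0 := by
    refine pow_eq_zero_iff (two_ne_zero) |>.mp ?_
    linear_combination (-1 / 35) * q6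
  obtain rfl : a5 = 0 := by
    refine pow_eq_zero_iff (two_ne_zero) |>.mp ?_
    linear_combination (-1 / 126) * q4
  obtain rfl : a4 = 0 := by
    refine pow_eq_zero_iff (two_ne_zero) |>.mp ?_
    linear_combination (1 / 35) * k0
  simp

lemma X_pow_seven_dvd {f : MvPolynomial (Fin 2) ℂ} (hf : f.IsHomogeneous 10)
    (hj2 : transv 10 10 10 f f = 0) (hk : transv 10 10 8 f f = 0)
    (hq : transv 10 10 6 f f ≠ 0) (hdvd : X 0 ^ 5 ∣ transv 10 10 6 f f) :
    X 0 ^ 7 ∣ f := by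
  obtain ⟨a, rfl⟩ := exists_eq_normForm hf
  rw [transv_normForm_self 0 10 a] at hj2
  rw [transv_normForm_self 2 8 a] at hk
  rw [transv_normForm_self 4 6 a] at hq hdvd
  have hk (j : ℕ) (hj : j ≤ 4) := binForm_coeff_eq_zero hk (j := j) hj
  have hdvd (j : ℕ) (hj : j ≤ 8) (hj' : 4 ≤ j) :=
    binForm_coeff_eq_zero_of_X_pow_dvd hdvd (j := j) hj (by omega)
  have q4 := hdvd 4 (by norm_num) (by norm_num)
  have q5 := hdvd 5 (by norm_num) (by norm_num)
  have q6 := hdvd 6 (by norm_num) (by norm_num)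
  have q7 := hdvd 7 (by norm_num) (by norm_num)
  have q8 := hdvd 8 (by norm_num) (by norm_num)
  have k0 := hk 0 (by norm_num)
  have k1 := hk 1 (by norm_num)
  have k2 := hk 2 (by norm_num)
  have k3 := hk 3 (by norm_num)
  have k4 := hk 4 (by norm_num)
  have j0 := binForm_coeff_eq_zero hj2 (j := 0) le_rfl
  have hq : ¬ (transvCoeff 4 6 a 0 = 0 ∧ transvCoeff 4 6 a 1 = 0 ∧ transvCoeff 4 6 a 2 = 0 ∧
      transvCoeff 4 6 a 3 = 0) := by
    rintro ⟨q0, q1, q2, q3⟩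
    refine hq (binForm_eq_zero fun j hj => ?_)
    by_cases h : 4 ≤ j
    · exact hdvd j hj h
    · interval_cases j <;> assumption
  clear hk hdvd hj2
  simp [transvCoeff, prodCoeff, Finset.sum_range_succ, Nat.choose] at hq q4 q5 q6 q7 q8
  simp [transvCoeff, prodCoeff, Finset.sum_range_succ, Nat.choose] at k0 k1 k2 k3 k4 j0
  obtain ⟨h4, h5, h6, h7, h8, h9, h10⟩ := upper_coeffs_eq_zero (a 0) (a 1) (a 2) (a 3) (a 4) (a 5)
    (a 6) (a 7) (a 8) (a 9) (a 10)
    (by linear_combination (1 / 2) * q4)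
    (by linear_combination (1 / 8) * q5)
    (by linear_combination (1 / 4) * q6)
    (by linear_combination (1 / 8) * q7)
    (by linear_combination (1 / 2) * q8)
    (by linear_combination (1 / 2) * k0)
    (by linear_combination (1 / 4) * k1)
    (by linear_combination (1 / 2) * k2)
    (by linear_combination (1 / 4) * k3)
    (by linear_combination (1 / 2) * k4)
    (by linear_combination (1 / 2) * j0)
    (fun ⟨q0, q1, q2, q3⟩ => hq (by linear_combination 2 * q0) (by linear_combination 8 * q1)
      (by linear_combination 4 * q2) (by linear_combination 8 * q3))
  refine X_pow_dvd_binForm fun j hj hj' => ?_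
  replace hj' : 4 ≤ j := by omega
  interval_cases j <;> simp [h4, h5, h6, h7, h8, h9, h10]

/-- Let `f ∈ V₁₀`, `j₂ = (f,f)₁₀`, `k = (f,f)₈ ∈ V₄`, `q = (f,f)₆ ∈ V₈`. If `j₂ = 0`,
`k = 0`, `q ≠ 0` and `q` has a root of multiplicity at least 5 (i.e. `q` is a nullform
of `V₈`), then `f` has a root of multiplicity at least 7. -/
theorem k_zero_q_nullform_case (f : MvPolynomial (Fin 2) ℂ) (hf : f.IsHomogeneous 10)
    (hj2 : transv 10 10 10 f f = 0)
    (hk : transv 10 10 8 f f = 0)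
    (hq : transv 10 10 6 f f ≠ 0)
    (hqnull : HasRootOfMult 5 (transv 10 10 6 f f)) :
    HasRootOfMult 7 f := by
  obtain ⟨a, b, hab, hdvd⟩ := hqnull
  obtain ⟨c, d, hdet⟩ : ∃ c d : ℂ, a * d - b * c = 1 := by
    rcases hab with h | h
    · exact ⟨0, a⁻¹, by simp [h]⟩
    · exact ⟨-b⁻¹, 0, by simp [h]⟩
  have hdet' : d * a - -b * -c = 1 := by linear_combination hdet
  have hX : linSubst a b c d (X 0) = C a * X 0 + C b * X 1 := by simp [linSubst]
  have hinv (p : MvPolynomial (Fin 2) ℂ) : linSubst d (-b) (-c) a (linSubst a b c d p) = p := by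
    simpa using linSubst_linSubst_inv hdet' p
  have hlin : linSubst d (-b) (-c) a (C a * X 0 + C b * X 1) = X 0 := by
    rw [← hX, hinv]
  refine ⟨a, b, hab, ?_⟩
  have key : X 0 ^ 7 ∣ linSubst d (-b) (-c) a f := by
    refine X_pow_seven_dvd (linSubst_isHomogeneous _ _ _ _ hf) ?_ ?_ ?_ ?_
    · rw [transv_linSubst hdet', hj2, map_zero]
    · rw [transv_linSubst hdet', hk, map_zero]
    · rw [transv_linSubst hdet']
      intro h
      rw [← linSubst_linSubst_inv hdet (transv 10 10 6 f f), h, map_zero] at hq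
      exact hq rfl
    · rw [transv_linSubst hdet', ← hlin, ← map_pow]
      exact map_dvd _ hdvd
  have := map_dvd (linSubst a b c d) key
  rwa [linSubst_linSubst_inv hdet, map_pow, hX] at this
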